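/- Let β < 0 and 0 < α < 8/(d+n). Then there exists c₀ > 0 such that for all c > c₀, c^{-1} m_c < -β²/8. -/

import Mathlib

noncomputable section

open MeasureTheory Real Filter Set

namespace BNLS

/-- A point of `ℝ^d × 𝕋^n`, the torus being modelled by periodic functions on `ℝ^n`. -/
abbrev Pt (d n : ℕ) := (Fin d → ℝ) × (Fin n → ℝ)

/-- Fundamental domain `[0,2π)^n` of the torus `(ℝ/2πℤ)^n`. -/
def torusBox (n : ℕ) : Set (Fin n → ℝ) := Set.univ.pi fun _ => Set.Ico 0 (2*π)

/-- The measure of the torus `𝕋^n`. -/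
def μT (n : ℕ) : Measure (Fin n → ℝ) := volume.restrict (torusBox n)

/-- The measure of `ℝ^d × 𝕋^n`. -/
def μP (d n : ℕ) : Measure (Pt d n) := (volume : Measure (Fin d → ℝ)).prod (μT n)

/-- Partial derivative in the `i`-th `x`-direction. -/
def dX (d n : ℕ) (i : Fin d) (u : Pt d n → ℂ) : Pt d n → ℂ :=
  fun p => fderiv ℝ u p (Pi.single i 1, 0)

/-- Partial derivative in the `j`-th `y`-direction. -/
def dY (d n : ℕ) (j : Fin n) (u : Pt d n → ℂ) : Pt d n → ℂ :=
  fun p => fderiv ℝ u p (0, Pi.single j 1)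

/-- Partial Laplacian `Δ_x`. -/
def lapX (d n : ℕ) (u : Pt d n → ℂ) : Pt d n → ℂ := fun p => ∑ i, dX d n i (dX d n i u) p

/-- Partial Laplacian `Δ_y`. -/
def lapY (d n : ℕ) (u : Pt d n → ℂ) : Pt d n → ℂ := fun p => ∑ j, dY d n j (dY d n j u) p

/-- Full Laplacian `Δ_{x,y}`. -/
def lap (d n : ℕ) (u : Pt d n → ℂ) : Pt d n → ℂ := fun p => lapX d n u p + lapY d n u p

/-- Mass `‖u‖_{L²}²`. -/
def Mass (d n : ℕ) (u : Pt d n → ℂ) : ℝ := ∫ z, ‖u z‖^2 ∂(μP d n)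

/-- `‖u‖_{L^p}^p`. -/
def Npow (d n : ℕ) (p : ℝ) (u : Pt d n → ℂ) : ℝ := ∫ z, ‖u z‖ ^ p ∂(μP d n)

/-- The `L^p` norm. -/
def LpN (d n : ℕ) (p : ℝ) (u : Pt d n → ℂ) : ℝ := (Npow d n p u) ^ (1/p)

/-- `‖Δ u‖_{L²}²`. -/
def lapSq (d n : ℕ) (u : Pt d n → ℂ) : ℝ := ∫ z, ‖lap d n u z‖^2 ∂(μP d n)

/-- `‖Δ_x u‖_{L²}²`. -/
def lapXSq (d n : ℕ) (u : Pt d n → ℂ) : ℝ := ∫ z, ‖lapX d n u z‖^2 ∂(μP d n)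

/-- `‖Δ_y u‖_{L²}²`. -/
def lapYSq (d n : ℕ) (u : Pt d n → ℂ) : ℝ := ∫ z, ‖lapY d n u z‖^2 ∂(μP d n)

/-- `‖∇_x u‖_{L²}²`. -/
def gradXSq (d n : ℕ) (u : Pt d n → ℂ) : ℝ := ∫ z, (∑ i, ‖dX d n i u z‖^2) ∂(μP d n)

/-- `‖∇_y u‖_{L²}²`. -/
def gradYSq (d n : ℕ) (u : Pt d n → ℂ) : ℝ := ∫ z, (∑ j, ‖dY d n j u z‖^2) ∂(μP d n)

/-- `‖∇ u‖_{L²}²`. -/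
def gradSq (d n : ℕ) (u : Pt d n → ℂ) : ℝ := gradXSq d n u + gradYSq d n u

/-- Pointwise sum of squares of all second derivatives. -/
def hessInt (d n : ℕ) (u : Pt d n → ℂ) (z : Pt d n) : ℝ :=
  (∑ i, ∑ i', ‖dX d n i (dX d n i' u) z‖^2) + (∑ i, ∑ j, ‖dY d n j (dX d n i u) z‖^2)
  + (∑ j, ∑ i, ‖dX d n i (dY d n j u) z‖^2) + (∑ j, ∑ j', ‖dY d n j (dY d n j' u) z‖^2)

/-- `‖∇² u‖_{L²}²`. -/
def hessSq (d n : ℕ) (u : Pt d n → ℂ) : ℝ := ∫ z, hessInt d n u z ∂(μP d n)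

/-- The `H²` norm on `ℝ^d × 𝕋^n`. -/
def H2norm (d n : ℕ) (u : Pt d n → ℂ) : ℝ :=
  Real.sqrt (Mass d n u + gradSq d n u + hessSq d n u)

/-- `2π`-periodicity in all `y`-variables. -/
def Periodic (d n : ℕ) (u : Pt d n → ℂ) : Prop :=
  ∀ j : Fin n, ∀ p : Pt d n, u (p.1, p.2 + (2*π) • (Pi.single j 1 : Fin n → ℝ)) = u p

/-- Membership in `H²(ℝ^d × 𝕋^n)`. -/
def InH2 (d n : ℕ) (u : Pt d n → ℂ) : Prop :=
  ContDiff ℝ 2 u ∧ Periodic d n u ∧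
  Integrable (fun z => ‖u z‖^2) (μP d n) ∧
  Integrable (fun z => (∑ i, ‖dX d n i u z‖^2) + ∑ j, ‖dY d n j u z‖^2) (μP d n) ∧
  Integrable (hessInt d n u) (μP d n)

/-- The mass sphere `S(c)`. -/
def Sset (d n : ℕ) (c : ℝ) : Set (Pt d n → ℂ) := {u | InH2 d n u ∧ Mass d n u = c}

/-- The energy functional `E`. -/
def En (d n : ℕ) (β α : ℝ) (u : Pt d n → ℂ) : ℝ :=
  (1/2) * lapSq d n u + (β/2) * gradSq d n u - (1/(α+2)) * Npow d n (α+2) u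

/-- The ground state energy `m_c`. -/
def mC (d n : ℕ) (β α c : ℝ) : ℝ := sInf (En d n β α '' Sset d n c)

end BNLS
namespace BNLS

open scoped ENNReal

/-- Generic periodicity. -/
def Per (d n : ℕ) {X : Type*} (f : Pt d n → X) : Prop :=
  ∀ j : Fin n, ∀ p : Pt d n, f (p + (0, (2*π) • (Pi.single j 1 : Fin n → ℝ))) = f p

lemma Periodic.per {d n : ℕ} {u : Pt d n → ℂ} (h : Periodic d n u) : Per d n u := by
  intro j p
  have := h j p
  rw [← this]
  congr 1
  ext <;> simp

lemma Per.comp {d n : ℕ} {X Y : Type*} {f : Pt d n → X} (h : Per d n f) (g : X → Y) :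
    Per d n (fun z => g (f z)) := fun j p => by
  beta_reduce; rw [h j p]

lemma Per.comp₂ {d n : ℕ} {X Y Z : Type*} {f : Pt d n → X} {f' : Pt d n → Y}
    (h : Per d n f) (h' : Per d n f') (g : X → Y → Z) :
    Per d n (fun z => g (f z) (f' z)) := fun j p => by
  beta_reduce; rw [h j p, h' j p]

lemma Per.shift {d n : ℕ} {X : Type*} {f : Pt d n → X} (h : Per d n f) (w : Pt d n) :
    Per d n (fun z => f (z + w)) := fun j p => by
  beta_reduce; rw [add_right_comm, h j]

lemma Per.fderiv {d n : ℕ} {F : Type*} [NormedAddCommGroup F] [NormedSpace ℝ F]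
    {f : Pt d n → F} (h : Per d n f) : Per d n (fderiv ℝ f) := fun j p => by
  rw [← fderiv_comp_add_right]
  congr 1
  ext z
  exact h j z

/-- scaled basis -/
def bas (n : ℕ) : Module.Basis (Fin n) ℝ (Fin n → ℝ) :=
  (Pi.basisFun ℝ (Fin n)).isUnitSMul (w := fun _ => 2*π)
    (fun _ => isUnit_iff_ne_zero.2 (by positivity))

lemma bas_apply (n : ℕ) (j : Fin n) : bas n j = (2*π) • (Pi.single j 1 : Fin n → ℝ) := by
  simp [bas, Module.Basis.isUnitSMul_apply]

lemma bas_repr (n : ℕ) (j : Fin n) (m : Fin n → ℝ) : (bas n).repr m j = m j / (2*π) := by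
  have h : m = ∑ j, (m j / (2*π)) • bas n j := by
    ext k
    simp only [bas_apply, Finset.sum_apply, Pi.smul_apply, smul_eq_mul, Pi.single_apply]
    simp only [mul_ite, mul_one, mul_zero, Finset.sum_ite_eq, Finset.mem_univ, if_true]
    field_simp
  conv_lhs => rw [h]
  rw [Module.Basis.repr_sum_self]

lemma torusBox_eq (n : ℕ) : torusBox n = ZSpan.fundamentalDomain (bas n) := by
  ext m
  have hp : 0 < 2*π := by positivity
  simp only [torusBox, Set.mem_univ_pi, ZSpan.mem_fundamentalDomain, bas_repr, mem_Ico]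
  refine forall_congr' fun i => ?_
  rw [div_lt_one hp, le_div_iff₀ hp, zero_mul]

lemma torusBox_meas (n : ℕ) : MeasurableSet (torusBox n) := by
  rw [torusBox_eq]; exact ZSpan.fundamentalDomain_measurableSet _

lemma torus_shift (n : ℕ) (f : (Fin n → ℝ) → ℝ≥0∞)
    (hf : ∀ j y, f (y + (2*π) • (Pi.single j 1 : Fin n → ℝ)) = f y) (w : Fin n → ℝ) :
    ∫⁻ y, f (y + w) ∂(μT n) = ∫⁻ y, f y ∂(μT n) := by
  have hinv : ∀ g ∈ Submodule.span ℤ (Set.range (bas n)), ∀ y, f (g + y) = f y := by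
    intro g hg
    induction hg using Submodule.span_induction with
    | mem x hx =>
      obtain ⟨j, rfl⟩ := hx
      intro y; rw [bas_apply, add_comm, hf]
    | zero => simp
    | add x y _ _ hx hy => intro z; rw [add_assoc, hx, hy]
    | smul a x _ hx =>
      intro y
      induction a using Int.induction_on generalizing y with
      | zero => simp
      | succ i ih => rw [add_smul, one_smul, add_assoc, ih, hx]
      | pred i ih =>
        rw [← hx, sub_smul, one_smul]
        convert ih y using 2
        abel
  have h1 := ZSpan.isAddFundamentalDomain (bas n) (volume : Measure (Fin n → ℝ))
  have : VAddInvariantMeasure (Submodule.span ℤ (Set.range (bas n))) (Fin n → ℝ) volume :=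
    ⟨fun c s _ => measure_preimage_add (volume : Measure (Fin n → ℝ)) (c : Fin n → ℝ) s⟩
  have h2 := h1.vadd_of_comm w
  have h3 := h1.setLIntegral_eq h2 f (fun g x => by
    exact hinv g g.2 x)
  rw [μT, torusBox_eq]
  rw [h3]
  have := (measurePreserving_add_left (volume : Measure (Fin n → ℝ)) w).setLIntegral_comp_emb
    (measurableEmbedding_addLeft w) f (ZSpan.fundamentalDomain (bas n))
  simp only [add_comm _ w]
  rw [this]
  rfl

instance (n : ℕ) : SFinite (μT n) := by unfold μT; infer_instance
instance (n : ℕ) : IsFiniteMeasure (μT n) := by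
  unfold μT
  constructor
  rw [Measure.restrict_apply_univ, torusBox, Real.volume_pi_Ico]
  exact ENNReal.prod_lt_top (fun _ _ => ENNReal.ofReal_lt_top)
instance (d n : ℕ) : SFinite (μP d n) := by unfold μP; infer_instance

lemma lshift {d n : ℕ} {f : Pt d n → ℝ≥0∞} (hm : Measurable f) (hf : Per d n f) (w : Pt d n) :
    ∫⁻ z, f (z + w) ∂(μP d n) = ∫⁻ z, f z ∂(μP d n) := by
  unfold μP
  rw [lintegral_prod _ (by fun_prop), lintegral_prod _ hm.aemeasurable]
  have : ∀ x : Fin d → ℝ, ∫⁻ y, f ((x, y) + w) ∂(μT n) = ∫⁻ y, f (x + w.1, y) ∂(μT n) := by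
    intro x
    exact torus_shift n (fun y => f (x + w.1, y)) (fun j y => by
      have := hf j (x + w.1, y)
      simpa using this) w.2
  simp only [this]
  exact lintegral_add_right_eq_self (fun x => ∫⁻ y, f (x, y) ∂(μT n)) w.1

lemma ishift {d n : ℕ} {f : Pt d n → ℝ} (hm : Continuous f) (hf : Per d n f) (w : Pt d n) 
    (hi : Integrable f (μP d n)) : Integrable (fun z => f (z + w)) (μP d n) := by
  refine ⟨by fun_prop, ?_⟩
  have := hi.2
  unfold HasFiniteIntegral at *
  rwa [lshift (f := fun z => ‖f z‖ₑ) (by fun_prop) (hf.comp _) w]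

lemma shift {d n : ℕ} {f : Pt d n → ℝ} (hm : Continuous f) (hf : Per d n f) (w : Pt d n)
    (hi : Integrable f (μP d n)) : ∫ z, f (z + w) ∂(μP d n) = ∫ z, f z ∂(μP d n) := by
  rw [integral_eq_lintegral_pos_part_sub_lintegral_neg_part hi,
    integral_eq_lintegral_pos_part_sub_lintegral_neg_part (ishift hm hf w hi),
    lshift (f := fun z => ENNReal.ofReal (f z)) (by fun_prop) (hf.comp _) w,
    lshift (f := fun z => ENNReal.ofReal (-f z)) (by fun_prop) (hf.comp (fun x => ENNReal.ofReal (-x))) w]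

/-- continuous, periodic, square integrable -/
def L2 (d n : ℕ) (f : Pt d n → ℂ) : Prop :=
  Continuous f ∧ Per d n f ∧ Integrable (fun z => ‖f z‖^2) (μP d n)

lemma L2.shift {d n : ℕ} {f : Pt d n → ℂ} (h : L2 d n f) (w : Pt d n) :
    L2 d n (fun z => f (z + w)) := by
  obtain ⟨h1, h2, h3⟩ := h
  exact ⟨by fun_prop, h2.shift w, ishift (f := fun z => ‖f z‖^2) (by fun_prop)
    (h2.comp (fun x => ‖x‖^2)) w h3⟩

lemma L2.add {d n : ℕ} {f g : Pt d n → ℂ} (hf : L2 d n f) (hg : L2 d n g) :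
    L2 d n (fun z => f z + g z) := by
  obtain ⟨h1, h2, h3⟩ := hf
  obtain ⟨k1, k2, k3⟩ := hg
  refine ⟨by fun_prop, h2.comp₂ k2 _, ?_⟩
  refine Integrable.mono' ((h3.const_mul 2).add (k3.const_mul 2)) (by fun_prop) ?_
  refine Eventually.of_forall fun z => ?_
  simp only [Pi.add_apply, norm_pow, norm_norm]
  nlinarith [norm_add_le (f z) (g z), norm_nonneg (f z + g z), sq_nonneg (‖f z‖ - ‖g z‖),
    norm_nonneg (f z), norm_nonneg (g z)]

lemma L2.neg {d n : ℕ} {f : Pt d n → ℂ} (hf : L2 d n f) :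
    L2 d n (fun z => - f z) := by
  obtain ⟨h1, h2, h3⟩ := hf
  exact ⟨by fun_prop, h2.comp _, by simpa using h3⟩

lemma L2.sub {d n : ℕ} {f g : Pt d n → ℂ} (hf : L2 d n f) (hg : L2 d n g) :
    L2 d n (fun z => f z - g z) := by
  simpa [sub_eq_add_neg] using hf.add hg.neg

lemma L2.zero {d n : ℕ} : L2 d n (fun _ => 0) :=
  ⟨by fun_prop, fun _ _ => rfl, by simp⟩

lemma L2.sum {d n : ℕ} {ι : Type*} (s : Finset ι) {f : ι → Pt d n → ℂ}
    (hf : ∀ k, L2 d n (f k)) : L2 d n (fun z => ∑ k ∈ s, f k z) := by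
  classical
  induction s using Finset.induction_on with
  | empty => simpa using L2.zero
  | insert a s ha ih => simpa [Finset.sum_insert ha] using (hf a).add ih

lemma L2.inn {d n : ℕ} {f g : Pt d n → ℂ} (hf : L2 d n f) (hg : L2 d n g) :
    Integrable (fun z => inner ℝ (f z) (g z)) (μP d n) := by
  obtain ⟨h1, h2, h3⟩ := hf
  obtain ⟨k1, k2, k3⟩ := hg
  refine Integrable.mono' (h3.add k3) (by fun_prop) ?_
  refine Eventually.of_forall fun z => ?_
  simp only [Pi.add_apply]
  have := norm_inner_le_norm (𝕜 := ℝ) (f z) (g z)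
  nlinarith [sq_nonneg (‖f z‖ - ‖g z‖), sq_nonneg (‖f z‖), sq_nonneg (‖g z‖)]

lemma line {d n : ℕ} {F : Type*} [NormedAddCommGroup F] [NormedSpace ℝ F] [CompleteSpace F]
    {f : Pt d n → F} (hf : ContDiff ℝ 1 f) (z w : Pt d n) :
    f (z + w) - f z = ∫ t in (0:ℝ)..1, fderiv ℝ f (z + t • w) w := by
  have hc : Continuous (fderiv ℝ f) := hf.continuous_fderiv (by norm_num)
  have h := intervalIntegral.integral_eq_sub_of_hasDerivAt (a := 0) (b := 1)
    (f := fun t : ℝ => f (z + t • w)) (f' := fun t => fderiv ℝ f (z + t • w) w) (fun t _ => by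
      have h1 : HasFDerivAt f (fderiv ℝ f (z + t • w)) (z + t • w) :=
        (hf.differentiable (by norm_num) _).hasFDerivAt
      have h2 : HasDerivAt (fun t : ℝ => z + t • w) w t := by
        simpa using ((hasDerivAt_id t).smul_const w).const_add z
      exact h1.comp_hasDerivAt t h2) (by
      apply Continuous.intervalIntegrable
      exact (hc.comp (by fun_prop)).clm_apply continuous_const)
  rw [h]; simp

lemma sq_int {F : Type*} [NormedAddCommGroup F] [NormedSpace ℝ F]
    {g : ℝ → F} (hg : Continuous g) :
    ‖∫ t in (0:ℝ)..1, g t‖^2 ≤ ∫ t in (0:ℝ)..1, ‖g t‖^2 := by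
  have h1 : ‖∫ t in (0:ℝ)..1, g t‖ ≤ ∫ t in (0:ℝ)..1, ‖g t‖ :=
    intervalIntegral.norm_integral_le_integral_norm (by norm_num)
  set a := ∫ t in (0:ℝ)..1, ‖g t‖ with ha
  have h2 : 0 ≤ ∫ t in (0:ℝ)..1, (‖g t‖ - a)^2 :=
    intervalIntegral.integral_nonneg (by norm_num) (fun t _ => sq_nonneg _)
  have h3 : ∫ t in (0:ℝ)..1, (‖g t‖ - a)^2 = (∫ t in (0:ℝ)..1, ‖g t‖^2) - a^2 := by
    have : ∀ t, (‖g t‖ - a)^2 = ‖g t‖^2 - 2*a*‖g t‖ + a^2 := fun t => by ring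
    simp only [this]
    rw [intervalIntegral.integral_add, intervalIntegral.integral_sub,
      intervalIntegral.integral_const_mul, ← ha]
    · simp; ring
    all_goals exact Continuous.intervalIntegrable (by fun_prop) _ _
  have h4 := norm_nonneg (∫ t in (0:ℝ)..1, g t)
  nlinarith

lemma diff_bound {d n : ℕ} {f : Pt d n → ℂ} (hf : ContDiff ℝ 1 f) (hp : Per d n f) (w : Pt d n)
    (hi : Integrable (fun z => ‖fderiv ℝ f z w‖^2) (μP d n)) :
    Integrable (fun z => ‖f (z + w) - f z‖^2) (μP d n) ∧
    ∫ z, ‖f (z + w) - f z‖^2 ∂(μP d n) ≤ ∫ z, ‖fderiv ℝ f z w‖^2 ∂(μP d n) := by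
  have hc : Continuous (fderiv ℝ f) := hf.continuous_fderiv (by norm_num)
  have hc0 : Continuous f := hf.continuous
  have key : ∫⁻ z, ENNReal.ofReal (‖f (z + w) - f z‖^2) ∂(μP d n) ≤
      ∫⁻ z, ENNReal.ofReal (‖fderiv ℝ f z w‖^2) ∂(μP d n) := by
    have hpt : ∀ z, ENNReal.ofReal (‖f (z + w) - f z‖^2) ≤
        ∫⁻ t in Ioc (0:ℝ) 1, ENNReal.ofReal (‖fderiv ℝ f (z + t • w) w‖^2) := by
      intro z
      have hcz : Continuous (fun t : ℝ => fderiv ℝ f (z + t • w) w) :=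
        (hc.comp (by fun_prop)).clm_apply continuous_const
      rw [← ofReal_integral_eq_lintegral_ofReal]
      · apply ENNReal.ofReal_le_ofReal
        rw [line hf, ← intervalIntegral.integral_of_le (by norm_num)]
        exact sq_int hcz
      · exact (Continuous.intervalIntegrable (u := fun t => ‖fderiv ℝ f (z + t • w) w‖^2) (by fun_prop) 0 1).1
      · exact Eventually.of_forall fun t => sq_nonneg _
    refine (lintegral_mono hpt).trans ?_
    rw [lintegral_lintegral_swap]
    · have : ∀ t : ℝ, ∫⁻ z, ENNReal.ofReal (‖fderiv ℝ f (z + t • w) w‖^2) ∂(μP d n) =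
          ∫⁻ z, ENNReal.ofReal (‖fderiv ℝ f z w‖^2) ∂(μP d n) := fun t =>
        lshift (f := fun z => ENNReal.ofReal (‖fderiv ℝ f z w‖^2))
          (by
            have := hc.clm_apply (continuous_const (y := w))
            exact (ENNReal.continuous_ofReal.comp (this.norm.pow 2)).measurable) 
          (hp.fderiv.comp (fun L => ENNReal.ofReal (‖L w‖^2))) (t • w)
      simp only [this]
      simp
    · apply Measurable.aemeasurable
      apply Continuous.measurable
      have : Continuous (fun x : Pt d n × ℝ => fderiv ℝ f (x.1 + x.2 • w) w) :=
        (hc.comp (by fun_prop)).clm_apply continuous_const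
      exact ENNReal.continuous_ofReal.comp (this.norm.pow 2)
  have hI : Integrable (fun z => ‖f (z + w) - f z‖^2) (μP d n) := by
    refine ⟨by fun_prop, ?_⟩
    rw [hasFiniteIntegral_iff_ofReal (Eventually.of_forall fun _ => sq_nonneg _)]
    refine key.trans_lt ?_
    rw [← hasFiniteIntegral_iff_ofReal (Eventually.of_forall fun _ => sq_nonneg _)]
    exact hi.2
  refine ⟨hI, ?_⟩
  rw [← ofReal_integral_eq_lintegral_ofReal hI (Eventually.of_forall fun _ => sq_nonneg _),
    ← ofReal_integral_eq_lintegral_ofReal hi (Eventually.of_forall fun _ => sq_nonneg _)] at key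
  exact (ENNReal.ofReal_le_ofReal_iff (integral_nonneg fun _ => sq_nonneg _)).1 key

lemma ibp0 {d n : ℕ} {g : Pt d n → ℝ} (hg : ContDiff ℝ 1 g) (hp : Per d n g) (w : Pt d n)
    (h0 : Integrable g (μP d n)) (hi : Integrable (fun z => fderiv ℝ g z w) (μP d n)) :
    ∫ z, fderiv ℝ g z w ∂(μP d n) = 0 := by
  have hc : Continuous (fderiv ℝ g) := hg.continuous_fderiv (by norm_num)
  have hc0 : Continuous g := hg.continuous
  have hcw : Continuous (fun z => fderiv ℝ g z w) := hc.clm_apply continuous_const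
  have hpw : Per d n (fun z => fderiv ℝ g z w) := hp.fderiv.comp (fun L => L w)
  have e1 : ∫ z, (g (z + w) - g z) ∂(μP d n) = 0 := by
    rw [integral_sub (ishift hc0 hp w h0) h0, shift hc0 hp w h0, sub_self]
  simp only [line hg, intervalIntegral.integral_of_le (zero_le_one' ℝ)] at e1
  have hc2 : Continuous (fun x : Pt d n × ℝ => fderiv ℝ g (x.1 + x.2 • w) w) :=
        (hc.comp (by fun_prop)).clm_apply continuous_const
  rw [integral_integral_swap] at e1
  · have : ∀ t : ℝ, ∫ z, fderiv ℝ g (z + t • w) w ∂(μP d n) = ∫ z, fderiv ℝ g z w ∂(μP d n) :=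
      fun t => shift hcw hpw (t • w) hi
    simpa [this] using e1
  · refine (integrable_prod_iff' (by simpa [Function.uncurry_def] using hc2.aestronglyMeasurable)).2 ⟨?_, ?_⟩
    · exact Eventually.of_forall fun t => ishift hcw hpw (t • w) hi
    · have : ∀ t : ℝ, ∫ z, ‖fderiv ℝ g (z + t • w) w‖ ∂(μP d n) = ∫ z, ‖fderiv ℝ g z w‖ ∂(μP d n) :=
        fun t => shift (f := fun z => ‖fderiv ℝ g z w‖) hcw.norm (hpw.comp _) (t • w) hi.norm
      simp only [Function.uncurry_def, this]
      exact integrable_const _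

/-- coordinate vectors -/
def ee (d n : ℕ) : Fin d ⊕ Fin n → Pt d n
  | Sum.inl i => (Pi.single i 1, 0)
  | Sum.inr j => (0, Pi.single j 1)

/-- coordinates -/
def co {d n : ℕ} (w : Pt d n) : Fin d ⊕ Fin n → ℝ
  | Sum.inl i => w.1 i
  | Sum.inr j => w.2 j

lemma sum_co {d n : ℕ} (w : Pt d n) : w = ∑ k, co w k • ee d n k := by
  rw [Fintype.sum_sum_type]
  ext i
  · simp [co, ee, Prod.fst_sum, Finset.sum_apply, Pi.single_apply]
  · simp [co, ee, Prod.snd_sum, Finset.sum_apply, Pi.single_apply]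

/-- coordinate derivative -/
def dd {d n : ℕ} (k : Fin d ⊕ Fin n) (u : Pt d n → ℂ) : Pt d n → ℂ :=
  fun p => fderiv ℝ u p (ee d n k)

lemma lap_eq {d n : ℕ} (u : Pt d n → ℂ) (z : Pt d n) : lap d n u z = ∑ k, dd k (dd k u) z := by
  rw [Fintype.sum_sum_type]; rfl

/-- working version of `InH2` -/
structure HH (d n : ℕ) (u : Pt d n → ℂ) : Prop where
  cd : ContDiff ℝ 2 u
  l0 : L2 d n u
  l1 : ∀ k, L2 d n (dd k u)
  l2 : ∀ k, L2 d n (dd k (dd k u))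

lemma dd_cd {d n : ℕ} {u : Pt d n → ℂ} (h : ContDiff ℝ 2 u) (k : Fin d ⊕ Fin n) :
    ContDiff ℝ 1 (dd k u) :=
  (h.fderiv_right (m := 1) (by norm_num)).clm_apply contDiff_const

lemma dd_cont {d n : ℕ} {u : Pt d n → ℂ} (h : ContDiff ℝ 1 u) (k : Fin d ⊕ Fin n) :
    Continuous (dd k u) :=
  (h.continuous_fderiv (by norm_num)).clm_apply continuous_const

lemma dd_per {d n : ℕ} {u : Pt d n → ℂ} (h : Per d n u) (k : Fin d ⊕ Fin n) :
    Per d n (dd k u) := h.fderiv.comp (fun L => L (ee d n k))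

lemma InH2.hh {d n : ℕ} {u : Pt d n → ℂ} (h : InH2 d n u) : HH d n u := by
  obtain ⟨h1, h2, h3, h4, h5⟩ := h
  have hp := h2.per
  have c1 := fun k => dd_cd h1 k
  have c2 := fun k => dd_cont (c1 k) k
  refine ⟨h1, ⟨h1.continuous, hp, h3⟩, fun k => ⟨(c1 k).continuous, dd_per hp k, ?_⟩,
    fun k => ⟨c2 k, dd_per (dd_per hp k) k, ?_⟩⟩
  · have cc := (c1 k).continuous
    refine Integrable.mono' h4 (by fun_prop) (Eventually.of_forall fun z => ?_)
    have : (∑ i, ‖dX d n i u z‖^2) + ∑ j, ‖dY d n j u z‖^2 = ∑ k, ‖dd k u z‖^2 := by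
      rw [Fintype.sum_sum_type]; rfl
    simp only [norm_pow, norm_norm]
    rw [this]
    exact Finset.single_le_sum (f := fun k => ‖dd k u z‖^2) (fun _ _ => sq_nonneg _) (Finset.mem_univ k)
  · have cc := c2 k
    refine Integrable.mono' h5 (by fun_prop) (Eventually.of_forall fun z => ?_)
    simp only [norm_pow, norm_norm]
    unfold hessInt
    have a1 : 0 ≤ ∑ i, ∑ j, ‖dY d n j (dX d n i u) z‖^2 := by positivity
    have a2 : 0 ≤ ∑ j, ∑ i, ‖dX d n i (dY d n j u) z‖^2 := by positivity
    have a3 : 0 ≤ ∑ i, ∑ i', ‖dX d n i (dX d n i' u) z‖^2 := by positivity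
    have a4 : 0 ≤ ∑ j, ∑ j', ‖dY d n j (dY d n j' u) z‖^2 := by positivity
    rcases k with i | j
    · have b1 : ‖dX d n i (dX d n i u) z‖^2 ≤ ∑ i', ‖dX d n i (dX d n i' u) z‖^2 :=
        Finset.single_le_sum (f := fun i' => ‖dX d n i (dX d n i' u) z‖^2)
          (fun _ _ => sq_nonneg _) (Finset.mem_univ i)
      have b2 : ∑ i', ‖dX d n i (dX d n i' u) z‖^2 ≤ ∑ i, ∑ i', ‖dX d n i (dX d n i' u) z‖^2 :=
        Finset.single_le_sum (f := fun i => ∑ i', ‖dX d n i (dX d n i' u) z‖^2)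
          (fun _ _ => by positivity) (Finset.mem_univ i)
      change ‖dX d n i (dX d n i u) z‖^2 ≤ _
      linarith
    · have b1 : ‖dY d n j (dY d n j u) z‖^2 ≤ ∑ i', ‖dY d n j (dY d n i' u) z‖^2 :=
        Finset.single_le_sum (f := fun i' => ‖dY d n j (dY d n i' u) z‖^2)
          (fun _ _ => sq_nonneg _) (Finset.mem_univ j)
      have b2 : ∑ i', ‖dY d n j (dY d n i' u) z‖^2 ≤ ∑ i, ∑ i', ‖dY d n i (dY d n i' u) z‖^2 :=
        Finset.single_le_sum (f := fun i => ∑ i', ‖dY d n i (dY d n i' u) z‖^2)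
          (fun _ _ => by positivity) (Finset.mem_univ j)
      change ‖dY d n j (dY d n j u) z‖^2 ≤ _
      linarith

lemma dd_shift {d n : ℕ} (k : Fin d ⊕ Fin n) (u : Pt d n → ℂ) (w : Pt d n) :
    dd k (fun z => u (z + w)) = fun z => dd k u (z + w) := by
  ext z; unfold dd; rw [fderiv_comp_add_right]

lemma dd_sub {d n : ℕ} (k : Fin d ⊕ Fin n) {u v : Pt d n → ℂ} (hu : ContDiff ℝ 1 u)
    (hv : ContDiff ℝ 1 v) :
    dd k (fun z => u z - v z) = fun z => dd k u z - dd k v z := by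
  ext z; unfold dd
  rw [fderiv_fun_sub (hu.differentiable (by norm_num) z) (hv.differentiable (by norm_num) z)]
  rfl

lemma dd_diff {d n : ℕ} (k : Fin d ⊕ Fin n) {u : Pt d n → ℂ} (hu : ContDiff ℝ 1 u) (w : Pt d n) :
    dd k (fun z => u (z + w) - u z) = fun z => dd k u (z + w) - dd k u z := by
  have h1 : ContDiff ℝ 1 (fun z => u (z + w)) := hu.comp (contDiff_id.add contDiff_const)
  rw [dd_sub k h1 hu, dd_shift]

lemma HH.diff {d n : ℕ} {u : Pt d n → ℂ} (h : HH d n u) (w : Pt d n) :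
    HH d n (fun z => u (z + w) - u z) := by
  have h1 : ContDiff ℝ 1 u := h.cd.of_le (by norm_num)
  refine ⟨(h.cd.comp (contDiff_id.add contDiff_const)).sub h.cd, (h.l0.shift w).sub h.l0,
    fun k => ?_, fun k => ?_⟩
  · rw [dd_diff k h1]; exact ((h.l1 k).shift w).sub (h.l1 k)
  · rw [dd_diff k h1, dd_diff k (dd_cd h.cd k)]; exact ((h.l2 k).shift w).sub (h.l2 k)

lemma HH.lap {d n : ℕ} {u : Pt d n → ℂ} (h : HH d n u) : L2 d n (lap d n u) := by
  have : BNLS.lap d n u = fun z => ∑ k, dd k (dd k u) z := by ext z; exact lap_eq u z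
  rw [this]; exact L2.sum _ h.l2

lemma lap_diff {d n : ℕ} {u : Pt d n → ℂ} (h : HH d n u) (w z : Pt d n) :
    lap d n (fun z => u (z + w) - u z) z = lap d n u (z + w) - lap d n u z := by
  have h1 : ContDiff ℝ 1 u := h.cd.of_le (by norm_num)
  simp only [lap_eq, ← Finset.sum_sub_distrib]
  refine Finset.sum_congr rfl fun k _ => ?_
  rw [dd_diff k h1, dd_diff k (dd_cd h.cd k)]

lemma HH.ibp {d n : ℕ} {u : Pt d n → ℂ} (h : HH d n u) (k : Fin d ⊕ Fin n) :
    ∫ z, ‖dd k u z‖^2 ∂(μP d n) = - ∫ z, inner ℝ (dd k (dd k u) z) (u z) ∂(μP d n) := by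
  have h1 : ContDiff ℝ 1 u := h.cd.of_le (by norm_num)
  have h2 := dd_cd h.cd k
  have hfd : (fun z => fderiv ℝ (fun z => inner ℝ (dd k u z) (u z)) z (ee d n k)) =
      fun z => ‖dd k u z‖^2 + inner ℝ (dd k (dd k u) z) (u z) := by
    ext z
    rw [fderiv_inner_apply ℝ (h2.differentiable (by norm_num) z) (h1.differentiable (by norm_num) z)]
    change inner ℝ (dd k u z) (dd k u z) + inner ℝ (dd k (dd k u) z) (u z) = _
    rw [real_inner_self_eq_norm_sq]
  have hi := (h.l1 k).2.2
  have hj := (h.l2 k).inn h.l0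
  have := ibp0 (g := fun z => inner ℝ (dd k u z) (u z)) (h2.inner ℝ h1)
    ((h.l1 k).2.1.comp₂ h.l0.2.1 _) (ee d n k) ((h.l1 k).inn h.l0)
    (by rw [hfd]; exact hi.add hj)
  rw [hfd, integral_add hi hj] at this
  linarith

lemma HH.ibp_sum {d n : ℕ} {u : Pt d n → ℂ} (h : HH d n u) :
    ∑ k, ∫ z, ‖dd k u z‖^2 ∂(μP d n) = - ∫ z, inner ℝ (BNLS.lap d n u z) (u z) ∂(μP d n) := by
  simp only [h.ibp, lap_eq, sum_inner]
  rw [integral_finsetSum _ (fun k _ => (h.l2 k).inn h.l0), Finset.sum_neg_distrib]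

lemma L2.cs {d n : ℕ} {f g : Pt d n → ℂ} (hf : L2 d n f) (hg : L2 d n g) (a : ℝ) (ha : 0 < a) :
    |∫ z, inner ℝ (f z) (g z) ∂(μP d n)| ≤ a/2 * ∫ z, ‖f z‖^2 ∂(μP d n) +
      1/(2*a) * ∫ z, ‖g z‖^2 ∂(μP d n) := by
  rw [← integral_const_mul, ← integral_const_mul,
    ← integral_add (hf.2.2.const_mul _) (hg.2.2.const_mul _)]
  refine (abs_integral_le_integral_abs).trans ?_
  refine integral_mono (hf.inn hg).abs ((hf.2.2.const_mul _).add (hg.2.2.const_mul _)) fun z => ?_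
  refine (abs_real_inner_le_norm (f z) (g z)).trans ?_
  have : a/2 * ‖f z‖^2 + 1/(2*a) * ‖g z‖^2 - ‖f z‖ * ‖g z‖ = 1/(2*a) * (a * ‖f z‖ - ‖g z‖)^2 := by
    field_simp; ring
  have h2 : 0 ≤ 1/(2*a) * (a * ‖f z‖ - ‖g z‖)^2 := by positivity
  linarith

lemma gradSq_eq {d n : ℕ} {u : Pt d n → ℂ} (h : HH d n u) :
    gradSq d n u = ∑ k, ∫ z, ‖dd k u z‖^2 ∂(μP d n) := by
  unfold gradSq gradXSq gradYSq
  rw [Fintype.sum_sum_type, integral_finsetSum, integral_finsetSum]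
  · rfl
  · exact fun j _ => (h.l1 (Sum.inr j)).2.2
  · exact fun j _ => (h.l1 (Sum.inl j)).2.2

lemma grad_le {d n : ℕ} {u : Pt d n → ℂ} (h : HH d n u) (a : ℝ) (ha : 0 < a) :
    gradSq d n u ≤ a/2 * lapSq d n u + 1/(2*a) * Mass d n u := by
  rw [gradSq_eq h, h.ibp_sum]
  exact (neg_le_abs _).trans (h.lap.cs h.l0 a ha)

/-- squared euclidean length -/
def sqn {d n : ℕ} (w : Pt d n) : ℝ := ∑ k, co w k ^ 2

lemma dir_le {d n : ℕ} (f : Pt d n → ℂ) (w z : Pt d n) :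
    ‖fderiv ℝ f z w‖^2 ≤ sqn w * ∑ k, ‖dd k f z‖^2 := by
  have : fderiv ℝ f z w = ∑ k, co w k • dd k f z := by
    conv_lhs => rw [sum_co w]
    simp [dd]
  rw [this]
  have h1 : ‖∑ k, co w k • dd k f z‖ ≤ ∑ k, |co w k| * ‖dd k f z‖ := by
    refine (norm_sum_le _ _).trans (le_of_eq ?_)
    simp
  have h2 := Finset.sum_mul_sq_le_sq_mul_sq Finset.univ (fun k => |co w k|) (fun k => ‖dd k f z‖)
  simp only [sq_abs] at h2
  exact (pow_le_pow_left₀ (norm_nonneg _) h1 2).trans h2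

/-- second difference -/
def del {d n : ℕ} (w : Pt d n) (u : Pt d n → ℂ) (z : Pt d n) : ℂ := u (z + w) + u (z - w) - 2 * u z

lemma del_L2 {d n : ℕ} {u : Pt d n → ℂ} (h : L2 d n u) (w : Pt d n) : L2 d n (del w u) := by
  have := ((h.shift w).sub h).add ((h.shift (-w)).sub h)
  convert this using 1
  ext z; simp only [del, sub_eq_add_neg]; ring

lemma del_bound {d n : ℕ} {u : Pt d n → ℂ} (h : HH d n u) (w : Pt d n) :
    ∫ z, ‖del w u z‖^2 ∂(μP d n) ≤ sqn w ^ 2 * lapSq d n u := by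
  set f : Pt d n → ℂ := fun z => u (z + w) - u z with hf
  have hF := h.diff w
  rw [← hf] at hF
  have h1 : ContDiff ℝ 1 f := hF.cd.of_le (by norm_num)
  have hd := del_L2 h.l0 w
  have hsq : 0 ≤ sqn w := Finset.sum_nonneg fun _ _ => sq_nonneg _
  have hdc : Continuous (fun z => fderiv ℝ f z w) :=
    (h1.continuous_fderiv (by norm_num)).clm_apply continuous_const
  have hI : Integrable (fun z => ‖fderiv ℝ f z w‖^2) (μP d n) := by
    refine Integrable.mono' ((integrable_finsetSum Finset.univ
      (fun k _ => (hF.l1 k).2.2)).const_mul (sqn w)) (by fun_prop) (Eventually.of_forall fun z => ?_)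
    simp only [norm_pow, norm_norm]
    exact dir_le f w z
  have s1 := (diff_bound h1 hF.l0.2.1 w hI).2
  have s2 : ∫ z, ‖f (z + w) - f z‖^2 ∂(μP d n) = ∫ z, ‖del w u z‖^2 ∂(μP d n) := by
    rw [← shift (f := fun z => ‖del w u z‖^2) (hd.1.norm.pow 2) (hd.2.1.comp (fun x => ‖x‖^2)) w hd.2.2]
    congr 1; ext z
    simp only [hf, del, add_sub_cancel_right]
    congr 2; ring
  have s3 : ∫ z, ‖fderiv ℝ f z w‖^2 ∂(μP d n) ≤ sqn w * ∑ k, ∫ z, ‖dd k f z‖^2 ∂(μP d n) := by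
    rw [← integral_finsetSum _ (fun k _ => (hF.l1 k).2.2), ← integral_const_mul]
    exact integral_mono hI ((integrable_finsetSum Finset.univ
      (fun k _ => (hF.l1 k).2.2)).const_mul (sqn w)) (fun z => dir_le f w z)
  have s4 : - ∫ z, inner ℝ (lap d n f z) (f z) ∂(μP d n) =
      ∫ z, inner ℝ (lap d n u z) (del w u z) ∂(μP d n) := by
    have hL := h.lap
    have e1 : ∀ z, inner ℝ (lap d n f z) (f z) =
        inner ℝ (lap d n u (z + w)) (f z) - inner ℝ (lap d n u z) (f z) := fun z => by
      rw [hf, lap_diff h, inner_sub_left]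
    have e2 : ∫ z, inner ℝ (lap d n u (z + w)) (f z) ∂(μP d n) =
        ∫ z, inner ℝ (lap d n u z) (f (z - w)) ∂(μP d n) := by
      have hs := hF.l0.shift (-w)
      rw [← shift (f := fun z => inner ℝ (lap d n u z) (f (z - w))) _ _ w]
      · simp
      · simpa [sub_eq_add_neg] using hL.inn hs
      · exact hL.1.inner (hF.l0.1.comp (by fun_prop))
      · have := hL.2.1.comp₂ hs.2.1 (fun a b => (inner ℝ a b : ℝ))
        simpa [sub_eq_add_neg] using this
    have hs := hF.l0.shift (-w)
    simp only [e1]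
    rw [integral_sub ((hL.shift w).inn hF.l0) (hL.inn hF.l0), e2, ← integral_sub, ← integral_neg]
    · congr 1; ext z
      rw [← inner_sub_right, ← inner_neg_right]
      congr 1
      simp only [hf, del, sub_add_cancel]
      ring
    · simpa [sub_eq_add_neg] using hL.inn hs
    · exact hL.inn hF.l0
  rw [hF.ibp_sum, s4] at s3
  rw [s2] at s1
  rcases hsq.eq_or_lt with h0 | h0
  · rw [← h0] at s3 ⊢
    simp only [zero_mul] at s3
    have : (0:ℝ)^2 * lapSq d n u = 0 := by ring
    rw [this]; linarith
  · have s5 := (le_abs_self _).trans (h.lap.cs hd (sqn w) h0)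
    have s6 := s1.trans (s3.trans (mul_le_mul_of_nonneg_left s5 hsq))
    have : sqn w * (sqn w / 2 * ∫ z, ‖lap d n u z‖^2 ∂(μP d n) + 1/(2 * sqn w) * ∫ z, ‖del w u z‖^2 ∂(μP d n))
      = sqn w ^2 / 2 * (∫ z, ‖lap d n u z‖^2 ∂(μP d n)) + 1/2 * ∫ z, ‖del w u z‖^2 ∂(μP d n) := by
      field_simp
    rw [this] at s6
    unfold lapSq
    linarith

lemma μP_eq (d n : ℕ) : μP d n = (volume : Measure (Pt d n)).restrict (univ ×ˢ torusBox n) := by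
  rw [Measure.volume_eq_prod, ← Measure.prod_restrict, Measure.restrict_univ]; rfl

instance haarPt (d n : ℕ) : (volume : Measure (Pt d n)).IsAddHaarMeasure := by
  rw [Measure.volume_eq_prod]; exact Measure.prod.instIsAddHaarMeasure _ _

/-- cube -/
def BB (d n : ℕ) (r : ℝ) : Set (Pt d n) := Icc (fun _ => -r) (fun _ => r) ×ˢ Icc (fun _ => -r) (fun _ => r)

lemma BB_meas (d n : ℕ) (r : ℝ) : MeasurableSet (BB d n r) := measurableSet_Icc.prod measurableSet_Icc

lemma BB_vol (d n : ℕ) (r : ℝ) (hr : 0 ≤ r) : volume (BB d n r) = ENNReal.ofReal ((2*r)^(d+n)) := by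
  have h : r - -r = 2 * r := by ring
  rw [BB, Measure.volume_eq_prod, Measure.prod_prod, Real.volume_Icc_pi, Real.volume_Icc_pi]
  simp only [h, Finset.prod_const, Finset.card_univ, Fintype.card_fin]
  rw [← pow_add, ENNReal.ofReal_pow (by positivity)]

lemma BB_neg (d n : ℕ) (r : ℝ) (s : Pt d n) : -s ∈ BB d n r ↔ s ∈ BB d n r := by
  simp only [BB, mem_prod, mem_Icc, Pi.le_def, Prod.fst_neg, Prod.snd_neg, Pi.neg_apply]
  constructor <;> rintro ⟨⟨h1, h2⟩, ⟨h3, h4⟩⟩ <;>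
    refine ⟨⟨fun i => ?_, fun i => ?_⟩, ⟨fun i => ?_, fun i => ?_⟩⟩ <;>
    first | linarith [h1 i, h2 i] | linarith [h3 i, h4 i]

lemma BB_sqn {d n : ℕ} {r : ℝ} {s : Pt d n} (hs : s ∈ BB d n r) : sqn s ≤ (d + n) * r^2 := by
  obtain ⟨⟨h1, h2⟩, ⟨h3, h4⟩⟩ := hs
  have : ∀ k, co s k ^ 2 ≤ r^2 := by
    rintro (i | j)
    · exact sq_le_sq' (h1 i) (h2 i)
    · exact sq_le_sq' (h3 j) (h4 j)
  refine (Finset.sum_le_sum fun k _ => this k).trans (le_of_eq ?_)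
  simp

lemma box_le {d n : ℕ} {F : Pt d n → ℝ≥0∞} (hm : Measurable F) (hp : Per d n F) {r : ℝ}
    (hr : r < π) (x : Pt d n) :
    ∫⁻ s in BB d n r, F (x + s) ≤ ∫⁻ z, F z ∂(μP d n) := by
  set c : Pt d n := (fun _ => r, fun _ => r)
  rw [← lshift hm hp (x - c), μP_eq, ← lintegral_indicator (BB_meas d n r),
    ← lintegral_indicator (MeasurableSet.univ.prod (torusBox_meas n)),
    ← lintegral_sub_right_eq_self _ c]
  refine lintegral_mono fun t => ?_
  by_cases h : t - c ∈ BB d n r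
  · have h' : t ∈ (univ : Set (Fin d → ℝ)) ×ˢ torusBox n := by
      obtain ⟨-, ⟨h3, h4⟩⟩ := h
      refine ⟨trivial, fun j _ => ?_⟩
      have a := h3 j
      have b := h4 j
      simp only [c, Prod.snd_sub, Pi.sub_apply] at a b
      constructor <;> linarith
    rw [indicator_of_mem h, indicator_of_mem h']
    apply le_of_eq; congr 1; abel
  · rw [indicator_of_notMem h]; exact zero_le

lemma box_le' {d n : ℕ} {F : Pt d n → ℝ≥0∞} (hm : Measurable F) (hp : Per d n F) {r : ℝ}
    (hr : r < π) (x : Pt d n) :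
    ∫⁻ s in BB d n r, F (x - s) ≤ ∫⁻ z, F z ∂(μP d n) := by
  have : (volume : Measure (Pt d n)).IsNegInvariant :=
    Measure.IsAddHaarMeasure.isNegInvariant_of_regular _
  refine le_trans (le_of_eq ?_) (box_le hm hp hr x)
  rw [← lintegral_indicator (BB_meas d n r), ← lintegral_indicator (BB_meas d n r),
    ← lintegral_neg_eq_self
      ((BB d n r).indicator fun s => F (x + s))]
  congr 1; ext s
  by_cases h : s ∈ BB d n r
  · rw [indicator_of_mem h, indicator_of_mem ((BB_neg d n r s).2 h), sub_eq_add_neg]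
  · rw [indicator_of_notMem h, indicator_of_notMem (fun hneg => h ((BB_neg d n r s).1 hneg))]

/-- averaged second difference -/
def GG {d n : ℕ} (u : Pt d n → ℂ) (r : ℝ) (x : Pt d n) : ℝ≥0∞ :=
  ∫⁻ s in BB d n r, ENNReal.ofReal (‖del s u x‖^2)

lemma L2.ofReal {d n : ℕ} {u : Pt d n → ℂ} (h : L2 d n u) :
    ∫⁻ z, ENNReal.ofReal (‖u z‖^2) ∂(μP d n) = ENNReal.ofReal (∫ z, ‖u z‖^2 ∂(μP d n)) :=
  (ofReal_integral_eq_lintegral_ofReal h.2.2 (Eventually.of_forall fun _ => sq_nonneg _)).symm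

lemma del_cont {d n : ℕ} {u : Pt d n → ℂ} (h : Continuous u) :
    Continuous (fun x : Pt d n × Pt d n => del x.2 u x.1) := by
  unfold del; fun_prop

lemma pt_bound {d n : ℕ} {u : Pt d n → ℂ} (h : L2 d n u) {r : ℝ} (h0 : 0 ≤ r) (hr : r < π)
    (x : Pt d n) (hx : 4 * Mass d n u < (2*r)^(d+n) * ‖u x‖^2) :
    ENNReal.ofReal ((2*r)^(d+n) * ‖u x‖^2) ≤ GG u r x := by
  have hc := h.1
  have hM : 0 ≤ Mass d n u := integral_nonneg fun _ => sq_nonneg _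
  have hm : Measurable (fun z => ENNReal.ofReal (‖u z‖^2)) := by fun_prop
  have hp : Per d n (fun z => ENNReal.ofReal (‖u z‖^2)) := h.2.1.comp (fun x => ENNReal.ofReal (‖x‖^2))
  have key : ENNReal.ofReal (2 * ((2*r)^(d+n) * ‖u x‖^2)) ≤ ENNReal.ofReal (4 * Mass d n u) + GG u r x := by
    have e1 : ENNReal.ofReal (2 * ((2*r)^(d+n) * ‖u x‖^2)) =
        ∫⁻ s in BB d n r, ENNReal.ofReal (2 * ‖u x‖^2) := by
      rw [setLIntegral_const, BB_vol d n r h0, ← ENNReal.ofReal_mul (by positivity)]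
      congr 1; ring
    have e2 : ∀ s, ENNReal.ofReal (2 * ‖u x‖^2) ≤ (2 * ENNReal.ofReal (‖u (x + s)‖^2) +
        2 * ENNReal.ofReal (‖u (x - s)‖^2)) + ENNReal.ofReal (‖del s u x‖^2) := by
      intro s
      have e : (2 : ℝ≥0∞) = ENNReal.ofReal 2 := by simp
      rw [e, ← ENNReal.ofReal_mul (by norm_num), ← ENNReal.ofReal_mul (by norm_num),
        ← ENNReal.ofReal_add (by positivity) (by positivity),
        ← ENNReal.ofReal_add (by positivity) (by positivity)]
      apply ENNReal.ofReal_le_ofReal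
      have t1 : 2 * ‖u x‖ ≤ ‖u (x + s)‖ + ‖u (x - s)‖ + ‖del s u x‖ := by
        have : 2 * u x = u (x + s) + u (x - s) - del s u x := by unfold del; ring
        calc 2 * ‖u x‖ = ‖2 * u x‖ := by simp
          _ ≤ ‖u (x + s) + u (x - s)‖ + ‖del s u x‖ := by rw [this]; exact norm_sub_le _ _
          _ ≤ _ := by gcongr; exact norm_add_le _ _
      have t2 : (2 * ‖u x‖)^2 ≤ (‖u (x + s)‖ + ‖u (x - s)‖ + ‖del s u x‖)^2 :=
        pow_le_pow_left₀ (by positivity) t1 2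
      nlinarith [sq_nonneg (‖u (x + s)‖ - ‖u (x - s)‖),
        sq_nonneg (‖u (x + s)‖ + ‖u (x - s)‖ - ‖del s u x‖)]
    rw [e1]
    refine (lintegral_mono e2).trans ?_
    rw [lintegral_add_left (by fun_prop), lintegral_add_left (by fun_prop),
      lintegral_const_mul _ (by fun_prop), lintegral_const_mul _ (by fun_prop)]
    refine add_le_add ?_ le_rfl
    have b1 := box_le hm hp hr x
    have b2 := box_le' hm hp hr x
    rw [h.ofReal] at b1 b2
    refine (add_le_add (mul_le_mul_right b1 2) (mul_le_mul_right b2 2)).trans (le_of_eq ?_)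
    have e : (4 : ℝ≥0∞) = ENNReal.ofReal 4 := by simp
    rw [ENNReal.ofReal_mul (by norm_num), ← e, ← add_mul]
    norm_num [Mass]
  by_cases hG : GG u r x = ⊤
  · rw [hG]; exact le_top
  · obtain ⟨g, hg⟩ := WithTop.ne_top_iff_exists.1 hG
    change (g : ℝ≥0∞) = _ at hg
    rw [← hg] at key ⊢
    rw [← ENNReal.ofReal_coe_nnreal, ← ENNReal.ofReal_add (by positivity) (by positivity),
      ENNReal.ofReal_le_ofReal_iff (by positivity)] at key
    rw [← ENNReal.ofReal_coe_nnreal]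
    apply ENNReal.ofReal_le_ofReal
    linarith

lemma GG_int {d n : ℕ} {u : Pt d n → ℂ} (h : HH d n u) {r : ℝ} (h0 : 0 ≤ r) :
    ∫⁻ x, GG u r x ∂(μP d n) ≤
      ENNReal.ofReal ((2*r)^(d+n) * (((d + n) * r^2)^2 * lapSq d n u)) := by
  have hc := h.l0.1
  have hL : 0 ≤ lapSq d n u := integral_nonneg fun _ => sq_nonneg _
  unfold GG
  rw [lintegral_lintegral_swap]
  · rw [ENNReal.ofReal_mul (by positivity), ← BB_vol d n r h0, mul_comm, ← setLIntegral_const]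
    refine setLIntegral_mono (by fun_prop) fun s hs => ?_
    rw [(del_L2 h.l0 s).ofReal]
    apply ENNReal.ofReal_le_ofReal
    refine (del_bound h s).trans ?_
    have := BB_sqn hs
    have hsq : 0 ≤ sqn s := Finset.sum_nonneg fun _ _ => sq_nonneg _
    gcongr
  · apply Measurable.aemeasurable
    exact (ENNReal.continuous_ofReal.comp ((del_cont hc).norm.pow 2)).measurable

lemma GG_meas {d n : ℕ} {u : Pt d n → ℂ} (h : Continuous u) (r : ℝ) : Measurable (GG u r) := by
  unfold GG
  apply Measurable.lintegral_prod_right'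
    (f := fun x : Pt d n × Pt d n => ENNReal.ofReal (‖del x.2 u x.1‖^2))
  exact (ENNReal.continuous_ofReal.comp ((del_cont h).norm.pow 2)).measurable

lemma gn_pt {d n : ℕ} (hd : 1 ≤ d) {u : Pt d n → ℂ} (h : HH d n u) {α : ℝ} (hα : 0 < α)
    (hM : 0 < Mass d n u) (K : ℕ) (x : Pt d n) :
    ENNReal.ofReal (‖u x‖ ^ (α+2)) ≤
      ENNReal.ofReal ((4 * Mass d n u * ((2:ℝ)^K)^(d+n)) ^ (α/2) * ‖u x‖^2) +
      ∑' k : ℕ, ENNReal.ofReal ((4 * Mass d n u * ((2:ℝ)^(K+k))^(d+n)) ^ (α/2) /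
        (2 * (2:ℝ)⁻¹^(K+k))^(d+n)) * GG u ((2:ℝ)⁻¹^(K+k)) x := by
  set M := Mass d n u
  have e0 : ‖u x‖ ^ (α+2) = (‖u x‖^2) ^ (α/2) * ‖u x‖^2 := by
    rw [Real.rpow_add_of_nonneg (norm_nonneg _) hα.le (by norm_num), ← Real.rpow_natCast,
      ← Real.rpow_mul (norm_nonneg _)]
    norm_num
    left; congr 1; ring
  rw [e0]
  by_cases hK : ‖u x‖^2 ≤ 4 * M * ((2:ℝ)^K)^(d+n)
  · refine le_trans ?_ le_self_add
    apply ENNReal.ofReal_le_ofReal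
    gcongr
  push Not at hK
  have hex : ∃ k : ℕ, ‖u x‖^2 ≤ 4 * M * ((2:ℝ)^(K+k))^(d+n) := by
    have ht : Tendsto (fun k : ℕ => (2:ℝ)^k) atTop atTop :=
      tendsto_pow_atTop_atTop_of_one_lt (by norm_num)
    obtain ⟨k, hk⟩ := (ht.eventually_ge_atTop (‖u x‖^2 / (4*M))).exists
    refine ⟨k, ?_⟩
    rw [div_le_iff₀ (by positivity)] at hk
    have h1 : (1:ℝ) ≤ 2^(K+k) := one_le_pow₀ (by norm_num)
    have h2 : (2:ℝ)^k ≤ 2^(K+k) := pow_le_pow_right₀ (by norm_num) (by omega)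
    have h3 : (2:ℝ)^(K+k) ≤ ((2:ℝ)^(K+k))^(d+n) := le_self_pow₀ h1 (by omega)
    nlinarith
  classical
  have hk := Nat.find_spec hex
  have hk' : ∀ m < Nat.find hex, ¬ _ := fun m hm => Nat.find_min hex hm
  generalize Nat.find hex = k0 at hk hk'
  rcases k0 with _ | k
  · exact absurd hk (not_le.2 (by simpa using hK))
  have hlow := hk' k (by omega)
  push Not at hlow
  have hV : (2 * (2:ℝ)⁻¹^(K+(k+1)))^(d+n) * (4 * M * ((2:ℝ)^(K+k))^(d+n)) = 4 * M := by
    have : 2 * (2:ℝ)⁻¹^(K+(k+1)) * (2:ℝ)^(K+k) = 1 := by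
      rw [← add_assoc, pow_succ, inv_pow]; field_simp
    calc _ = 4 * M * (2 * (2:ℝ)⁻¹^(K+(k+1)) * (2:ℝ)^(K+k))^(d+n) := by rw [mul_pow (2 * (2:ℝ)⁻¹^(K+(k+1)))]; ring
      _ = 4 * M := by rw [this]; simp
  have hVpos : 0 < (2 * (2:ℝ)⁻¹^(K+(k+1)))^(d+n) := by positivity
  have hr : (2:ℝ)⁻¹^(K+(k+1)) < π := by
    have : (2:ℝ)⁻¹^(K+(k+1)) ≤ 1 := pow_le_one₀ (by norm_num) (by norm_num)
    linarith [Real.pi_gt_three]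
  have hpt := pt_bound h.l0 (r := (2:ℝ)⁻¹^(K+(k+1))) (by positivity) hr x (by
    change 4 * M < _
    rw [← hV]
    exact mul_lt_mul_of_pos_left hlow hVpos)
  refine le_trans ?_ le_add_self
  refine le_trans ?_ (ENNReal.le_tsum (k+1))
  refine le_trans ?_ (mul_le_mul_right hpt _)
  rw [← ENNReal.ofReal_mul (by positivity)]
  apply ENNReal.ofReal_le_ofReal
  have : (4 * M * ((2:ℝ)^(K+(k+1)))^(d+n)) ^ (α/2) / (2 * (2:ℝ)⁻¹^(K+(k+1)))^(d+n) *
      ((2 * (2:ℝ)⁻¹^(K+(k+1)))^(d+n) * ‖u x‖^2) =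
      (4 * M * ((2:ℝ)^(K+(k+1)))^(d+n)) ^ (α/2) * ‖u x‖^2 := by
    field_simp
  rw [this]
  gcongr

lemma gn {d n : ℕ} (hd : 1 ≤ d) {u : Pt d n → ℂ} (h : HH d n u) {α : ℝ} (hα : 0 < α)
    (hM : 0 < Mass d n u) {q : ℝ} (hq : q = (2:ℝ)^(((d:ℝ)+n)*α/2 - 4)) (hq1 : q < 1) (K : ℕ) :
    Npow d n (α+2) u ≤ (4 * Mass d n u * ((2:ℝ)^K)^(d+n)) ^ (α/2) * Mass d n u +
      (4 * Mass d n u) ^ (α/2) * ((d:ℝ)+n)^2 * lapSq d n u * (q^K / (1-q)) := by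
  have hc := h.l0.1
  have hL : 0 ≤ lapSq d n u := integral_nonneg fun _ => sq_nonneg _
  have hq0 : 0 < q := by rw [hq]; positivity
  have hterm : ∀ k : ℕ, ∫⁻ x, ENNReal.ofReal ((4 * Mass d n u * ((2:ℝ)^(K+k))^(d+n)) ^ (α/2) /
        (2 * (2:ℝ)⁻¹^(K+k))^(d+n)) * GG u ((2:ℝ)⁻¹^(K+k)) x ∂(μP d n) ≤
        ENNReal.ofReal ((4 * Mass d n u) ^ (α/2) * ((d:ℝ)+n)^2 * lapSq d n u * q^K * q^k) := by
    intro k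
    rw [lintegral_const_mul _ (GG_meas hc _)]
    refine (mul_le_mul_right (GG_int h (r := (2:ℝ)⁻¹^(K+k)) (by positivity)) _).trans ?_
    rw [← ENNReal.ofReal_mul (by positivity)]
    apply ENNReal.ofReal_le_ofReal
    apply le_of_eq
    have hqk : q^(K+k) = (((2:ℝ)^(K+k))^(d+n))^(α/2) * (((2:ℝ)⁻¹^(K+k))^2)^2 := by
      rw [hq, ← Real.rpow_natCast, ← Real.rpow_mul (by norm_num), ← pow_mul, ← Real.rpow_natCast (2:ℝ),
        ← Real.rpow_mul (by norm_num), ← pow_mul, ← pow_mul, inv_pow, ← Real.rpow_natCast (2:ℝ),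
        ← Real.rpow_neg (by norm_num), ← Real.rpow_add (by norm_num)]
      congr 1
      push_cast
      ring
    rw [mul_assoc _ (q^K), ← pow_add, hqk, Real.mul_rpow (by positivity) (by positivity)]
    field_simp
  have hs : HasSum (fun k : ℕ => (4 * Mass d n u) ^ (α/2) * ((d:ℝ)+n)^2 * lapSq d n u * q^K * q^k)
      ((4 * Mass d n u) ^ (α/2) * ((d:ℝ)+n)^2 * lapSq d n u * q^K * (1-q)⁻¹) :=
    (hasSum_geometric_of_lt_one hq0.le hq1).mul_left _
  have key : ∫⁻ x, ENNReal.ofReal (‖u x‖ ^ (α+2)) ∂(μP d n) ≤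
      ENNReal.ofReal ((4 * Mass d n u * ((2:ℝ)^K)^(d+n)) ^ (α/2) * Mass d n u +
      (4 * Mass d n u) ^ (α/2) * ((d:ℝ)+n)^2 * lapSq d n u * (q^K / (1-q))) := by
    have h1q : 0 < 1 - q := by linarith
    refine (lintegral_mono (gn_pt hd h hα hM K)).trans ?_
    rw [lintegral_add_left (by fun_prop), ENNReal.ofReal_add (by positivity) (by positivity),
      lintegral_tsum (fun k => ((GG_meas hc _).const_mul _).aemeasurable)]
    refine add_le_add ?_ ?_
    · simp only [ENNReal.ofReal_mul (by positivity : 0 ≤ (4 * Mass d n u * ((2:ℝ)^K)^(d+n)) ^ (α/2))]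
      rw [lintegral_const_mul _ (by fun_prop), h.l0.ofReal]
      rfl
    · refine (ENNReal.tsum_le_tsum hterm).trans (le_of_eq ?_)
      rw [← ENNReal.ofReal_tsum_of_nonneg (fun k => by positivity) hs.summable, hs.tsum_eq]
      congr 1
      rw [div_eq_mul_inv]; ring
  unfold Npow
  have h1q : 0 < 1 - q := by linarith
  rw [integral_eq_lintegral_of_nonneg_ae (Eventually.of_forall fun _ => by positivity)
    (by
      apply Continuous.aestronglyMeasurable
      exact hc.norm.rpow_const (fun _ => Or.inr (by linarith)))]
  exact ENNReal.toReal_le_of_le_ofReal (by positivity) key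

lemma bddBelow {d n : ℕ} (hd : 1 ≤ d) (β : ℝ) {α : ℝ} (hβ : β < 0) (hα : 0 < α)
    (hα' : α < 8 / ((d:ℝ)+n)) {c : ℝ} (hc : 0 < c) : BddBelow (En d n β α '' Sset d n c) := by
  have hD : 0 < (d:ℝ) + n := by
    have : (1:ℝ) ≤ d := by exact_mod_cast hd
    positivity
  obtain ⟨q, hq⟩ : ∃ q, q = (2:ℝ)^(((d:ℝ)+n)*α/2 - 4) := ⟨_, rfl⟩
  have hq0 : 0 < q := by rw [hq]; positivity
  have hq1 : q < 1 := by
    rw [hq]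
    apply Real.rpow_lt_one_of_one_lt_of_neg (by norm_num)
    rw [lt_div_iff₀ hD] at hα'
    linarith
  have h1q : 0 < 1 - q := by linarith
  obtain ⟨K, hK⟩ : ∃ K : ℕ, (4 * c) ^ (α/2) * ((d:ℝ)+n)^2 * (q^K / (1-q)) ≤ 1/4 := by
    have ht : Tendsto (fun K : ℕ => (4 * c) ^ (α/2) * ((d:ℝ)+n)^2 * (q^K / (1-q))) atTop
        (nhds ((4 * c) ^ (α/2) * ((d:ℝ)+n)^2 * (0 / (1-q)))) :=
      ((tendsto_pow_atTop_nhds_zero_of_lt_one hq0.le hq1).div_const _).const_mul _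
    rw [zero_div, mul_zero] at ht
    exact (ht.eventually_le_const (by norm_num : (0:ℝ) < 1/4)).exists
  set P := (4 * c * ((2:ℝ)^K)^(d+n)) ^ (α/2) * c with hP
  have hP0 : 0 ≤ P := by positivity
  refine ⟨β / 2 * (1 / (2 * (1 / (-β))) * c) - P, ?_⟩
  rintro _ ⟨u, ⟨hu, hm⟩, rfl⟩
  have h := hu.hh
  have hL : 0 ≤ lapSq d n u := integral_nonneg fun _ => sq_nonneg _
  have g1 := gn hd h hα (by rw [hm]; exact hc) hq hq1 K
  have g2 := grad_le h (1/(-β)) (by apply div_pos one_pos; linarith)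
  rw [hm] at g1 g2
  have g3 : Npow d n (α+2) u ≤ P + 1/4 * lapSq d n u := by
    have := mul_le_mul_of_nonneg_right hK hL
    refine g1.trans ?_
    rw [← hP]
    linarith
  have g4 : 1/(α+2) * Npow d n (α+2) u ≤ P + 1/4 * lapSq d n u := by
    have : 1/(α+2) ≤ 1 := by rw [div_le_one (by linarith)]; linarith
    have hN : 0 ≤ Npow d n (α+2) u := integral_nonneg fun _ => by positivity
    nlinarith
  have g5 : β / 2 * (1/(-β)/2 * lapSq d n u + 1/(2*(1/(-β))) * c) ≤ β / 2 * gradSq d n u :=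
    mul_le_mul_of_nonpos_left g2 (by linarith)
  have g6 : β / 2 * (1/(-β)/2 * lapSq d n u) = - (1/4) * lapSq d n u := by
    have := hβ.ne
    field_simp
    ring
  unfold En
  rw [mul_add, g6] at g5
  linarith


/-- vanishing outside a ball in `x` -/
def ZZ {d n : ℕ} {X : Type*} [Zero X] (v : Pt d n → X) : Prop :=
  ∀ z : Pt d n, z.1 ∉ Metric.closedBall (0 : Fin d → ℝ) 2 → v z = 0

lemma ZZ.int {d n : ℕ} {g : Pt d n → ℝ} (hz : ZZ g) (hc : Continuous g) :
    Integrable g (μP d n) := by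
  rw [μP_eq]
  change IntegrableOn g _ _
  have h1 : IntegrableOn g (Metric.closedBall (0 : Fin d → ℝ) 2 ×ˢ
      Icc (fun _ => 0) (fun _ => 2*π) : Set (Pt d n)) volume :=
    hc.continuousOn.integrableOn_compact ((isCompact_closedBall _ _).prod isCompact_Icc)
  refine h1.of_forall_sdiff_eq_zero (MeasurableSet.univ.prod (torusBox_meas n)) ?_
  rintro z ⟨⟨-, h2⟩, h3⟩
  apply hz
  intro h4
  exact h3 ⟨h4, fun j => (h2 j trivial).1, fun j => (h2 j trivial).2.le⟩

lemma ZZ.fderiv {d n : ℕ} {v : Pt d n → ℂ} (hz : ZZ v) : ZZ (fderiv ℝ v) := by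
  intro z h
  have ho : IsOpen {z : Pt d n | z.1 ∉ Metric.closedBall (0 : Fin d → ℝ) 2} :=
    (Metric.isClosed_closedBall.isOpen_compl).preimage continuous_fst
  have : v =ᶠ[nhds z] fun _ => 0 := by
    filter_upwards [ho.mem_nhds h] with y hy using hz y hy
  rw [this.fderiv_eq]; simp

lemma ZZ.dX {d n : ℕ} {v : Pt d n → ℂ} (hz : ZZ v) (i : Fin d) : ZZ (dX d n i v) := fun z h => by
  simp [BNLS.dX, hz.fderiv z h]

lemma ZZ.dY {d n : ℕ} {v : Pt d n → ℂ} (hz : ZZ v) (i : Fin n) : ZZ (dY d n i v) := fun z h => by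
  simp [BNLS.dY, hz.fderiv z h]

lemma inH2_of_ZZ {d n : ℕ} {v : Pt d n → ℂ} (hz : ZZ v) (hc : ContDiff ℝ 2 v) (hp : Periodic d n v) :
    InH2 d n v := by
  have hc0 := hc.continuous
  have a1 : ∀ i, ContDiff ℝ 1 (dX d n i v) := fun i => dd_cd hc (Sum.inl i)
  have a2 : ∀ i, ContDiff ℝ 1 (dY d n i v) := fun i => dd_cd hc (Sum.inr i)
  have b1 := fun i => (a1 i).continuous
  have b2 := fun i => (a2 i).continuous
  have c1 : ∀ i j, Continuous (dX d n i (dX d n j v)) := fun i j => dd_cont (a1 j) (Sum.inl i)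
  have c2 : ∀ i j, Continuous (dY d n i (dX d n j v)) := fun i j => dd_cont (a1 j) (Sum.inr i)
  have c3 : ∀ i j, Continuous (dX d n i (dY d n j v)) := fun i j => dd_cont (a2 j) (Sum.inl i)
  have c4 : ∀ i j, Continuous (dY d n i (dY d n j v)) := fun i j => dd_cont (a2 j) (Sum.inr i)
  refine ⟨hc, hp, ZZ.int (fun z h => ?_) (by fun_prop), ZZ.int (fun z h => ?_) (by fun_prop),
    ZZ.int (fun z h => ?_) (by unfold hessInt; fun_prop)⟩
  · simp [hz z h]
  · simp [hz.dX _ z h, hz.dY _ z h]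
  · simp [hessInt, (hz.dX _).dX _ z h, (hz.dX _).dY _ z h, (hz.dY _).dX _ z h, (hz.dY _).dY _ z h]

lemma dX_smul {d n : ℕ} (a : ℝ) (v : Pt d n → ℂ) (i : Fin d) :
    dX d n i (a • v) = a • dX d n i v := by
  ext z; simp only [dX, fderiv_const_smul_field]; rfl

lemma dY_smul {d n : ℕ} (a : ℝ) (v : Pt d n → ℂ) (i : Fin n) :
    dY d n i (a • v) = a • dY d n i v := by
  ext z; simp only [dY, fderiv_const_smul_field]; rfl

lemma Mass_smul {d n : ℕ} (a : ℝ) (v : Pt d n → ℂ) : Mass d n (a • v) = a^2 * Mass d n v := by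
  unfold Mass
  rw [← integral_const_mul]
  congr 1; ext z
  simp [mul_pow]

lemma Npow_smul {d n : ℕ} (a p : ℝ) (ha : 0 ≤ a) (v : Pt d n → ℂ) :
    Npow d n p (a • v) = a^p * Npow d n p v := by
  unfold Npow
  rw [← integral_const_mul]
  congr 1; ext z
  rw [Pi.smul_apply, norm_smul, Real.norm_of_nonneg ha, Real.mul_rpow ha (norm_nonneg _)]

lemma lapSq_smul {d n : ℕ} (a : ℝ) (v : Pt d n → ℂ) : lapSq d n (a • v) = a^2 * lapSq d n v := by
  unfold lapSq
  rw [← integral_const_mul]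
  congr 1; ext z
  have : lap d n (a • v) z = a • lap d n v z := by
    simp only [lap, lapX, lapY, dX_smul, dY_smul, Pi.smul_apply, smul_add, Finset.smul_sum]
  rw [this, norm_smul, mul_pow]; simp

lemma gradSq_smul {d n : ℕ} (a : ℝ) (v : Pt d n → ℂ) : gradSq d n (a • v) = a^2 * gradSq d n v := by
  unfold gradSq gradXSq gradYSq
  rw [mul_add, ← integral_const_mul, ← integral_const_mul]
  simp only [dX_smul, dY_smul, Pi.smul_apply, norm_smul, mul_pow, Finset.mul_sum, norm_eq_abs, sq_abs]

lemma exists_test (d n : ℕ) (α : ℝ) (hα : 0 < α) : ∃ v : Pt d n → ℂ, ZZ v ∧ ContDiff ℝ 2 v ∧ Periodic d n v ∧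
    0 < Mass d n v ∧ 0 < Npow d n (α+2) v := by
  let f : ContDiffBump (0 : Fin d → ℝ) := ⟨1, 2, by norm_num, by norm_num⟩
  have hf : ContDiff ℝ 2 (fun z : Pt d n => ((f z.1 : ℝ) : ℂ)) :=
    Complex.ofRealCLM.contDiff.comp ((f.contDiff (n := 2)).comp contDiff_fst)
  have hz : ZZ (fun z : Pt d n => ((f z.1 : ℝ) : ℂ)) := fun z h => by
    have : f z.1 = 0 := f.zero_of_le_dist (by
      simp only [Metric.mem_closedBall, not_le] at h
      exact h.le)
    simp [this]
  have pos : ∀ g : Pt d n → ℝ, Continuous g → ZZ g → (∀ z, 0 ≤ g z) →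
      (∀ z : Pt d n, z.1 ∈ Metric.ball (0 : Fin d → ℝ) 1 → g z ≠ 0) → 0 < ∫ z, g z ∂(μP d n) := by
    intro g g1 g2 g3 g4
    rw [integral_pos_iff_support_of_nonneg g3 (g2.int g1)]
    have hsub : (Metric.ball (0 : Fin d → ℝ) 1) ×ˢ (univ : Set (Fin n → ℝ)) ⊆ Function.support g :=
      fun z hz => g4 z hz.1
    refine lt_of_lt_of_le ?_ (measure_mono hsub)
    rw [μP, Measure.prod_prod]
    apply ENNReal.mul_pos
    · exact (Metric.measure_ball_pos _ _ one_pos).ne'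
    · rw [μT, Measure.restrict_apply_univ, torusBox, Real.volume_pi_Ico]
      refine Finset.prod_ne_zero_iff.2 fun i _ => ?_
      simp [Real.pi_pos]
  have h1 : ∀ z : Pt d n, z.1 ∈ Metric.ball (0 : Fin d → ℝ) 1 → f z.1 = 1 := fun z h =>
    f.one_of_mem_closedBall (Metric.ball_subset_closedBall h)
  have hc := hf.continuous
  refine ⟨_, hz, hf, fun j p => rfl, ?_, ?_⟩
  · refine pos _ (by fun_prop) (fun z h => ?_) (fun z => by positivity) (fun z h => ?_)
    · simp only [hz z h]; simp
    · simp [h1 z h]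
  · refine pos _ (hc.norm.rpow_const (fun _ => Or.inr (by linarith))) (fun z h => ?_)
      (fun z => by positivity) (fun z h => ?_)
    · simp only [hz z h, norm_zero]; exact Real.zero_rpow (by linarith)
    · simp [h1 z h]

end BNLS

open BNLS in
/-- `c⁻¹ m_c < -β²/8` for all large `c`, when `β < 0`. -/
theorem stmt_9 (d n : ℕ) (hd : 1 ≤ d) (hn : 1 ≤ n) (β α : ℝ)
    (hβ : β < 0) (hα : 0 < α) (hα' : α < 8 / ((d:ℝ)+n)) :
    ∃ c₀ > (0:ℝ), ∀ c : ℝ, c₀ < c → mC d n β α c / c < -β^2 / 8 := by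
  obtain ⟨v, hz, hcd, hp, hm, hN⟩ := exists_test d n α hα
  set m := Mass d n v
  set N := Npow d n (α+2) v
  set Q := 1/2 * lapSq d n v + β/2 * gradSq d n v with hQ
  have hα2 : 0 < α + 2 := by linarith
  have ht : Tendsto (fun c : ℝ => (c/m)^(α/2)) atTop atTop :=
    (tendsto_rpow_atTop (by positivity)).comp (tendsto_id.atTop_div_const hm)
  obtain ⟨c₁, hc₁⟩ := eventually_atTop.1
    (ht.eventually_gt_atTop ((Q/m + β^2/8) / (N / (m * (α+2)))))
  refine ⟨max c₁ 1, by positivity, fun c hc => ?_⟩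
  have hc0 : 0 < c := lt_of_lt_of_le one_pos ((le_max_right _ _).trans hc.le)
  have hb := hc₁ c ((le_max_left _ _).trans hc.le)
  rw [div_lt_iff₀ (by positivity)] at hb
  set a := Real.sqrt (c/m) with ha
  have ha0 : 0 ≤ a := Real.sqrt_nonneg _
  have ha2 : a^2 = c/m := Real.sq_sqrt (by positivity)
  have hap : a^(α+2) = (c/m)^(α/2) * (c/m) := by
    rw [Real.rpow_add_of_nonneg ha0 hα.le (by norm_num), Real.rpow_two, ha2, ha, Real.sqrt_eq_rpow,
      ← Real.rpow_mul (by positivity)]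
    congr 2; ring
  have hz' : ZZ (a • v) := fun z h => by simp [hz z h]
  have hmem : a • v ∈ Sset d n c := by
    refine ⟨inH2_of_ZZ hz' (contDiff_const.smul hcd) (fun j p => ?_), ?_⟩
    · simp only [Pi.smul_apply]; rw [hp j p]
    · rw [Mass_smul, ha2]; exact div_mul_cancel₀ _ hm.ne'
  have hle : mC d n β α c ≤ En d n β α (a • v) :=
    csInf_le (bddBelow hd β hβ hα hα' hc0) ⟨_, hmem, rfl⟩
  have hE : En d n β α (a • v) / c = Q/m - (c/m)^(α/2) * (N / (m * (α+2))) := by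
    unfold En
    rw [lapSq_smul, gradSq_smul, Npow_smul _ _ ha0, hap, ha2, hQ]
    change (1/2 * (c/m * lapSq d n v) + β/2 * (c/m * gradSq d n v) -
      1/(α+2) * ((c/m)^(α/2) * (c/m) * N)) / c = _
    generalize (c/m)^(α/2) = X
    field_simp
  have := div_le_div_of_nonneg_right hle hc0.le
  linarith
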